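/- arXiv:2406.12941 — 2 statements merged into one kernel-verified Lean document; each statement's English description precedes it below -/
import Mathlib

section
/- Let 2 < m ≤ n+1 and let α = (a_1, …, a_m) ∈ [n]^m be such that (a_2, …, a_{m−1}) ∈ Sh_{m−1}(k−1, n−k) for some k ∈ [n]. Let (a_{i_1}, …, a_{i_{m−n+k−2}}) (with i_1 < ⋯ < i_{m−n+k−2}) be the subsequence of entries of (a_2, …, a_{m−1}) that are less than k. When m ≤ n, let j ∈ [k−1] be such that (a_{i_1}, …, a_{i_{m−n+k−2}}) ∈ Sh_{m−n+k−1}(j−1, k−j−1); when m = n+1, set j = 0. Then α is an (m−2)-metered (m,n)-parking function if and only if either (a_1 ≤ j and a_m ≤ k) or (j < a_1 ≤ k and a_m ≤ a_1). -/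
/-- One step of the `t`-metered parking process on spots `1,…,n`:
given the outcome list `prev` for the cars that have already entered
(`prev[j-1] = some s` if car `j` parked in spot `s`, `none` if it failed to park),
compute the outcome list after the next car (with preference `pref`) tries to park.
When the next car enters, the occupied spots are exactly the spots of the previous
`t` cars that are still on the street (all earlier cars have already left), and the
entering car parks in the smallest unoccupied spot `≥ pref` among `1,…,n`, if any. -/
def parkStep (n t : ℕ) (prev : List (Option ℕ)) (pref : ℕ) : List (Option ℕ) :=
  let occ : List ℕ := (prev.drop (prev.length - t)).filterMap id
  prev ++ [((List.range' pref (n + 1 - pref)).filter (fun s => decide (s ∉ occ))).head?]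

/-- The outcome of the `t`-metered parking process on spots `1,…,n` for the
preference list `l` (car `i` prefers spot `l[i-1]`); the `i`-th entry is
`some s` if car `i` parks in spot `s`, and `none` if car `i` fails to park. -/
def parkOutcome (n t : ℕ) (l : List ℕ) : List (Option ℕ) :=
  l.foldl (parkStep n t) []

/-- `l` is a `t`-metered `(m,n)`-parking function: a preference list in `[n]^m`
under which every car parks in the `t`-metered parking scheme. -/
def MeteredPF (m n t : ℕ) (l : List ℕ) : Prop :=
  l.length = m ∧ (∀ x ∈ l, x ∈ Finset.Icc 1 n) ∧
    ∀ o ∈ parkOutcome n t l, o.isSome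

/-- `l` is a classical `(m,n)`-parking function: a preference list in `[n]^m` under
which every car parks when no car ever leaves (equivalently, the `t`-metered scheme
with `t = m`, under which no car leaves while cars are still arriving). -/
def ParkingFunction (m n : ℕ) (l : List ℕ) : Prop :=
  l.length = m ∧ (∀ x ∈ l, x ∈ Finset.Icc 1 n) ∧
    ∀ o ∈ parkOutcome n m l, o.isSome

/-- `IsShuffle β δ γ`: the word `γ` is a shuffle of the words `β` and `δ`, i.e. `γ`
can be partitioned into two complementary subsequences equal, in order, to `β`
and `δ`. -/
inductive IsShuffle : List ℕ → List ℕ → List ℕ → Prop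
  | nil : IsShuffle [] [] []
  | left {x : ℕ} {xs ys zs : List ℕ} : IsShuffle xs ys zs → IsShuffle (x :: xs) ys (x :: zs)
  | right {y : ℕ} {xs ys zs : List ℕ} : IsShuffle xs ys zs → IsShuffle xs (y :: ys) (y :: zs)

/-- `ShSet m n k` is the set `Sh_m(k-1, n-k)` of `(m,n)`-parking function shuffles:
sequences `(π_2, …, π_m)` that are shuffles of some `α ∈ PF_{m-n+k-1, k-1}` and a word
`β + (k)^{n-k} = (b_1 + k, …, b_{n-k} + k)` with `β = (b_1,…,b_{n-k}) ∈ PF_{n-k, n-k}`.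
If `m - n + k - 1 < 0` (i.e. `m + k < n + 1`) the set is empty. -/
def ShSet (m n k : ℕ) : Set (List ℕ) :=
  {π | n + 1 ≤ m + k ∧ ∃ a b : List ℕ,
      ParkingFunction (m + k - n - 1) (k - 1) a ∧
      ParkingFunction (n - k) (n - k) b ∧
      IsShuffle a (b.map (· + k)) π}

/-- The smallest spot `≥ a` outside `S`, on a street without a last spot. -/
def nextFree (S : Finset ℕ) (a : ℕ) : ℕ :=
  Nat.find (p := fun s => a ≤ s ∧ s ∉ S) (by
    obtain ⟨s, hs⟩ := Infinite.exists_notMem_finset (S ∪ Finset.range a)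
    simp only [Finset.mem_union, Finset.mem_range, not_or, not_lt] at hs
    exact ⟨s, hs.2, hs.1⟩)

theorem nextFree_eq_iff {S : Finset ℕ} {a s : ℕ} :
    nextFree S a = s ↔ a ≤ s ∧ s ∉ S ∧ ∀ r, a ≤ r → r < s → r ∈ S := by
  unfold nextFree
  rw [Nat.find_eq_iff]
  grind

theorem nextFree_spec (S : Finset ℕ) (a : ℕ) :
    a ≤ nextFree S a ∧ nextFree S a ∉ S ∧ ∀ r, a ≤ r → r < nextFree S a → r ∈ S :=
  nextFree_eq_iff.1 rfl

theorem nextFree_le_iff {S : Finset ℕ} {a n : ℕ} :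
    nextFree S a ≤ n ↔ ∃ s, a ≤ s ∧ s ≤ n ∧ s ∉ S := by
  have h := nextFree_spec S a
  constructor
  · exact fun hn => ⟨_, h.1, hn, h.2.1⟩
  · rintro ⟨s, h1, h2, h3⟩
    by_contra hc
    exact h3 (h.2.2 s h1 (by omega))

/-- The occupied set after a car with preference `a` parks on a street without a last spot. -/
def occupy (S : Finset ℕ) (a : ℕ) : Finset ℕ := insert (nextFree S a) S

theorem occupy_right_comm (S : Finset ℕ) (a b : ℕ) :
    occupy (occupy S a) b = occupy (occupy S b) a := by
  have ha := nextFree_spec S a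
  have hb := nextFree_spec S b
  unfold occupy
  by_cases h : nextFree S a = nextFree S b
  · have h' : nextFree (insert (nextFree S a) S) b = nextFree (insert (nextFree S b) S) a := by
      rw [h] at ha ⊢
      have hc := nextFree_spec (insert (nextFree S b) S) a
      rw [nextFree_eq_iff]
      grind
    rw [h', h]
  · have h1 : nextFree (insert (nextFree S a) S) b = nextFree S b := by
      rw [nextFree_eq_iff]
      grind
    have h2 : nextFree (insert (nextFree S b) S) a = nextFree S a := by
      rw [nextFree_eq_iff]
      grind
    rw [h1, h2, Finset.insert_comm]

/-- The set of spots occupied by cars with preferences `l`, on a street without a last spot. -/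
def occupied (l : List ℕ) : Finset ℕ := l.foldl occupy ∅

theorem occupied_concat (l : List ℕ) (a : ℕ) :
    occupied (l ++ [a]) = insert (nextFree (occupied l) a) (occupied l) := by
  simp [occupied, occupy]

theorem occupied_perm {l l' : List ℕ} (h : l.Perm l') : occupied l = occupied l' :=
  haveI : RightCommutative occupy := ⟨occupy_right_comm⟩
  h.foldl_eq _

theorem card_occupied (l : List ℕ) : (occupied l).card = l.length := by
  induction l using List.reverseRecOn with
  | nil => simp [occupied]
  | append_singleton l a ih =>
    rw [occupied_concat, Finset.card_insert_of_notMem (nextFree_spec _ _).2.1, ih]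
    simp

theorem le_of_mem_occupied {l : List ℕ} {c : ℕ} (h : ∀ x ∈ l, c ≤ x) :
    ∀ s ∈ occupied l, c ≤ s := by
  induction l using List.reverseRecOn with
  | nil => simp [occupied]
  | append_singleton l a ih =>
    have hn := (nextFree_spec (occupied l) a).1
    have ha := h a (by simp)
    have ih := ih fun x hx => h x (by simp [hx])
    rw [occupied_concat]
    grind

theorem mem_occupied_map_add {l : List ℕ} {k s : ℕ} :
    s ∈ occupied (l.map (· + k)) ↔ ∃ r ∈ occupied l, r + k = s := by
  induction l using List.reverseRecOn generalizing s with
  | nil => simp [occupied]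
  | append_singleton l a ih =>
    have hn : nextFree (occupied (l.map (· + k))) (a + k) = nextFree (occupied l) a + k := by
      have h := nextFree_spec (occupied l) a
      rw [nextFree_eq_iff]
      refine ⟨by omega, ?_, fun r h1 h2 => ?_⟩
      · rw [ih]
        rintro ⟨r, hr, he⟩
        exact h.2.1 (by rwa [← Nat.add_right_cancel he])
      · exact ih.2 ⟨r - k, h.2.2 _ (by omega) (by omega), by omega⟩
    rw [List.map_append, List.map_singleton, occupied_concat, occupied_concat, hn]
    simp only [Finset.mem_insert, ih]
    grind

theorem occupied_append_of_lt {b a : List ℕ} {k : ℕ} (hb : ∀ s ∈ occupied b, k ≤ s)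
    (ha : ∀ s ∈ occupied a, s < k) : occupied (b ++ a) = occupied b ∪ occupied a := by
  induction a using List.reverseRecOn with
  | nil => simp [occupied]
  | append_singleton l c ih =>
    rw [occupied_concat] at ha
    have ih := ih fun s hs => ha s (Finset.mem_insert_of_mem hs)
    have hn : nextFree (occupied b ∪ occupied l) c = nextFree (occupied l) c := by
      have h := nextFree_spec (occupied l) c
      have := ha _ (Finset.mem_insert_self _ _)
      rw [nextFree_eq_iff]
      grind
    rw [← List.append_assoc, occupied_concat, occupied_concat, ih, hn, Finset.union_insert]

/-- The spots taken, in order of arrival, on a street without a last spot. -/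
def spots (l : List ℕ) : List ℕ := l.foldl (fun L a => L ++ [nextFree L.toFinset a]) []

theorem spots_concat (l : List ℕ) (a : ℕ) :
    spots (l ++ [a]) = spots l ++ [nextFree (spots l).toFinset a] := by
  simp [spots]

theorem length_spots (l : List ℕ) : (spots l).length = l.length := by
  induction l using List.reverseRecOn with
  | nil => simp [spots]
  | append_singleton l a ih => simp [spots_concat, ih]

theorem toFinset_spots (l : List ℕ) : (spots l).toFinset = occupied l := by
  induction l using List.reverseRecOn with
  | nil => simp [spots, occupied]
  | append_singleton l a ih =>
    rw [spots_concat, occupied_concat, List.toFinset_append, ih]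
    ext
    simp

theorem nodup_spots (l : List ℕ) : (spots l).Nodup := by
  rw [← Multiset.coe_nodup, ← Multiset.toFinset_card_eq_card_iff_nodup]
  simp [toFinset_spots, card_occupied, length_spots]

theorem spots_cons (x : ℕ) (l : List ℕ) : ∃ R, spots (x :: l) = x :: R := by
  induction l using List.reverseRecOn with
  | nil =>
    refine ⟨[], ?_⟩
    simp [spots, nextFree_eq_iff]
  | append_singleton l a ih =>
    obtain ⟨R, hR⟩ := ih
    rw [← List.cons_append, spots_concat, hR]
    exact ⟨_, rfl⟩

theorem parkOutcome_concat (n t : ℕ) (l : List ℕ) (a : ℕ) :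
    parkOutcome n t (l ++ [a]) = parkStep n t (parkOutcome n t l) a := by
  simp [parkOutcome]

theorem parkStep_map_some (n t : ℕ) (L : List ℕ) (a : ℕ) :
    parkStep n t (L.map some) a = L.map some ++
      [if nextFree (L.drop (L.length - t)).toFinset a ≤ n then
        some (nextFree (L.drop (L.length - t)).toFinset a) else none] := by
  have h := nextFree_spec (L.drop (L.length - t)).toFinset a
  unfold parkStep
  simp only [List.length_map, ← List.map_drop, List.filterMap_map, Function.id_comp,
    List.filterMap_some, List.head?_filter]
  congr 2
  split_ifs with hn
  · rw [List.find?_range'_eq_some]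
    grind [List.mem_toFinset]
  · rw [List.find?_eq_none]
    grind [List.mem_toFinset]

theorem parkOutcome_of_le {n t : ℕ} {l : List ℕ} (hl : l.length ≤ t + 1)
    (h : ∀ s ∈ occupied l, s ≤ n) : parkOutcome n t l = (spots l).map some := by
  induction l using List.reverseRecOn with
  | nil => simp [parkOutcome, spots]
  | append_singleton l a ih =>
    rw [occupied_concat] at h
    simp only [List.length_append, List.length_singleton] at hl
    have hd : (spots l).length - t = 0 := by rw [length_spots]; omega
    rw [parkOutcome_concat, ih (by omega) fun s hs => h s (Finset.mem_insert_of_mem hs),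
      parkStep_map_some, hd, List.drop_zero, toFinset_spots,
      if_pos (h _ (Finset.mem_insert_self _ _)), spots_concat, toFinset_spots]
    simp

theorem forall_isSome_parkOutcome_iff {n t : ℕ} {l : List ℕ} (hl : l.length ≤ t + 1) :
    (∀ o ∈ parkOutcome n t l, o.isSome) ↔ ∀ s ∈ occupied l, s ≤ n := by
  refine ⟨fun h => ?_, fun h => by simp [parkOutcome_of_le hl h]⟩
  induction l using List.reverseRecOn with
  | nil => simp [occupied]
  | append_singleton l a ih =>
    simp only [List.length_append, List.length_singleton] at hl
    rw [parkOutcome_concat] at h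
    have hS := ih (by omega) fun o ho => h o (by simp [parkStep, ho])
    have hd : (spots l).length - t = 0 := by rw [length_spots]; omega
    rw [parkOutcome_of_le (by omega) hS, parkStep_map_some, hd, List.drop_zero,
      toFinset_spots] at h
    have := h _ (List.mem_append_right _ (List.mem_singleton_self _))
    rw [occupied_concat]
    grind

theorem forall_isSome_parkOutcome_cons_concat_iff {n t x y : ℕ} {M : List ℕ}
    (hM : M.length = t) :
    (∀ o ∈ parkOutcome n t (x :: M ++ [y]), o.isSome) ↔
      (∀ s ∈ occupied (x :: M), s ≤ n) ∧ nextFree ((occupied (x :: M)).erase x) y ≤ n := by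
  have hl : (x :: M).length ≤ t + 1 := by simp [hM]
  have hprefix : (∀ o ∈ parkOutcome n t (x :: M ++ [y]), o.isSome) →
      ∀ s ∈ occupied (x :: M), s ≤ n := fun h =>
    (forall_isSome_parkOutcome_iff hl).1 fun o ho =>
      h o (by rw [parkOutcome_concat]; simp [parkStep, ho])
  refine (and_iff_right_of_imp hprefix).symm.trans (and_congr_right fun hS => ?_)
  obtain ⟨R, hR⟩ := spots_cons x M
  have hnd := nodup_spots (x :: M)
  have hlen := length_spots (x :: M)
  have herase : R.toFinset = (occupied (x :: M)).erase x := by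
    rw [← toFinset_spots, hR, List.toFinset_cons, Finset.erase_insert]
    rw [hR] at hnd
    simpa using (List.nodup_cons.1 hnd).1
  rw [hR] at hlen
  have hd : (x :: R).length - t = 1 := by rw [hlen]; simp [hM]
  rw [parkOutcome_concat, parkOutcome_of_le hl hS, hR, parkStep_map_some, hd, List.drop_one,
    List.tail_cons, herase]
  split_ifs with hn <;> simp [hn, or_imp, forall_and]

theorem ParkingFunction.mem_occupied {m n : ℕ} {l : List ℕ} (h : ParkingFunction m n l) :
    ∀ s ∈ occupied l, 1 ≤ s ∧ s ≤ n := fun s hs =>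
  ⟨le_of_mem_occupied (fun x hx => (Finset.mem_Icc.1 (h.2.1 x hx)).1) s hs,
    (forall_isSome_parkOutcome_iff (by rw [h.1]; omega)).1 h.2.2 s hs⟩

theorem ParkingFunction.occupied_eq {n : ℕ} {l : List ℕ} (h : ParkingFunction n n l) :
    occupied l = Finset.Icc 1 n :=
  Finset.eq_of_subset_of_card_le (fun s hs => Finset.mem_Icc.2 (h.mem_occupied s hs))
    (by simp [card_occupied, h.1])

theorem IsShuffle.perm {a b c : List ℕ} (h : IsShuffle a b c) : c.Perm (b ++ a) := by
  induction h with
  | nil => simp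
  | left _ ih => exact (ih.cons _).trans List.perm_middle.symm
  | right _ ih => exact ih.cons _

theorem IsShuffle.filter_eq {a b c : List ℕ} {p : ℕ → Bool} (h : IsShuffle a b c)
    (ha : ∀ x ∈ a, p x = true) (hb : ∀ x ∈ b, p x = false) : c.filter p = a := by
  induction h with
  | nil => simp
  | left _ ih =>
    rw [List.filter_cons_of_pos (ha _ (by simp)), ih (fun x hx => ha x (by simp [hx])) hb]
  | right _ ih =>
    rw [List.filter_cons_of_neg (by simp [hb]), ih ha (fun x hx => hb x (by simp [hx]))]

/-- A parking function shuffle fills every spot after `k`, leaves `k` free, and fills the spots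
before `k` as its entries below `k` do by themselves. -/
theorem occupied_of_mem_shSet {m n k : ℕ} {M : List ℕ} (hk : 1 ≤ k) (hkn : k ≤ n)
    (h : M ∈ ShSet m n k) :
    ParkingFunction (m + k - n - 1) (k - 1) (M.filter fun x => decide (x < k)) ∧
      occupied M = Finset.Ioc k n ∪ occupied (M.filter fun x => decide (x < k)) := by
  obtain ⟨-, a, b, ha, hb, hs⟩ := h
  have hf : M.filter (fun x => decide (x < k)) = a := by
    refine hs.filter_eq (fun x hx => ?_) (fun x hx => ?_)
    · have := Finset.mem_Icc.1 (ha.2.1 x hx)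
      simp only [decide_eq_true_eq]
      omega
    · obtain ⟨y, -, rfl⟩ := List.mem_map.1 hx
      simp
  have hb' : occupied (b.map (· + k)) = Finset.Ioc k n := by
    ext s
    rw [mem_occupied_map_add, hb.occupied_eq, Finset.mem_Ioc]
    constructor
    · rintro ⟨r, hr, rfl⟩
      rw [Finset.mem_Icc] at hr
      omega
    · exact fun h => ⟨s - k, Finset.mem_Icc.2 (by omega), by omega⟩
  rw [hf]
  refine ⟨ha, ?_⟩
  rw [occupied_perm hs.perm, occupied_append_of_lt (k := k), hb']
  · rw [hb']
    exact fun s hs => (Finset.mem_Ioc.1 hs).1.le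
  · intro s hs
    have := ha.mem_occupied s hs
    omega

/-- Let `2 < m ≤ n+1` and `α = (a_1,…,a_m) ∈ [n]^m` be such that
`(a_2,…,a_{m-1}) ∈ Sh_{m-1}(k-1, n-k)` for some `k ∈ [n]`.  Let
`(a_{i_1},…,a_{i_{m-n+k-2}})` be the subsequence of entries of `(a_2,…,a_{m-1})` that
are less than `k`.  When `m ≤ n`, let `j ∈ [k-1]` be such that this subsequence lies
in `Sh_{m-n+k-1}(j-1, k-j-1)`; when `m = n+1`, set `j = 0`.  Then `α` is an
`(m-2)`-metered `(m,n)`-parking function if and only if either (`a_1 ≤ j` and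
`a_m ≤ k`) or (`j < a_1 ≤ k` and `a_m ≤ a_1`).
(Here `(a_2,…,a_{m-1}) = (l.drop 1).take (m-2)`, `a_1 = l.getD 0 0`,
`a_m = l.getD (m-1) 0`, and `m - n + k - 1` is written `m + k - n - 1`, which agrees
with the integer value since membership in `Sh_{m-1}(k-1,n-k)` forces
`m + k ≥ n + 2`.) -/
theorem m_minus_two_metered_characterization (m n k j : ℕ) (h2 : 2 < m)
    (h3 : m ≤ n + 1) (l : List ℕ) (hlen : l.length = m)
    (hmem : ∀ x ∈ l, x ∈ Finset.Icc 1 n) (hk : k ∈ Finset.Icc 1 n)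
    (hsh : (l.drop 1).take (m - 2) ∈ ShSet (m - 1) n k)
    (hj : m ≤ n → j ∈ Finset.Icc 1 (k - 1) ∧
      ((l.drop 1).take (m - 2)).filter (fun x => decide (x < k)) ∈
        ShSet (m + k - n - 1) (k - 1) j)
    (hj0 : m = n + 1 → j = 0) :
    MeteredPF m n (m - 2) l ↔
      ((l.getD 0 0 ≤ j ∧ l.getD (m - 1) 0 ≤ k) ∨
       (j < l.getD 0 0 ∧ l.getD 0 0 ≤ k ∧ l.getD (m - 1) 0 ≤ l.getD 0 0)) := by
  obtain ⟨x, M, y, rfl⟩ : ∃ x M y, l = x :: M ++ [y] := by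
    obtain _ | ⟨x, l⟩ := l
    · simp at hlen; omega
    obtain rfl | ⟨M, y, rfl⟩ := l.eq_nil_or_concat
    · simp at hlen; omega
    · exact ⟨x, M, y, by simp⟩
  have hM : M.length = m - 2 := by simp at hlen; omega
  have hmid : ((x :: M ++ [y]).drop 1).take (m - 2) = M := by simp [← hM]
  have hy : (x :: M ++ [y]).getD (m - 1) 0 = y := by
    rw [show m - 1 = (x :: M).length by simp; omega]
    simp
  have hx : (x :: M ++ [y]).getD 0 0 = x := by simp
  have hx1 := Finset.mem_Icc.1 (hmem x (by simp))
  have hy1 := Finset.mem_Icc.1 (hmem y (by simp))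
  rw [hmid] at hsh hj
  rw [hx, hy]
  rw [Finset.mem_Icc] at hk
  obtain ⟨hpf, hocc⟩ := occupied_of_mem_shSet hk.1 hk.2 hsh
  set a := M.filter fun x => decide (x < k)
  have ha := hpf.mem_occupied
  have hja : j < k ∧ j ∉ occupied a ∧ ∀ s, j < s → s < k → s ∈ occupied a := by
    obtain hmn | hmn : m ≤ n ∨ m = n + 1 := by omega
    · obtain ⟨hjk, hja⟩ := hj hmn
      rw [Finset.mem_Icc] at hjk
      obtain ⟨hpf', hocc'⟩ := occupied_of_mem_shSet hjk.1 hjk.2 hja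
      have ha' := hpf'.mem_occupied
      rw [hocc']
      refine ⟨by omega, fun hmem => ?_, fun s h1 h2 => ?_⟩
      · rcases Finset.mem_union.1 hmem with h | h
        · simp at h
        · have := ha' j h
          omega
      · exact Finset.mem_union_left _ (Finset.mem_Ioc.2 (by omega))
    · rw [show m - 1 + k - n - 1 = k - 1 by omega] at hpf
      rw [hpf.occupied_eq, hj0 hmn]
      simp only [Finset.mem_Icc]
      exact ⟨by omega, by omega, fun s _ _ => by omega⟩
  have hS : occupied (x :: M) = insert (nextFree (occupied M) x) (occupied M) := by
    rw [← occupied_concat]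
    exact occupied_perm (List.perm_append_singleton x M).symm
  have hmet : MeteredPF m n (m - 2) (x :: M ++ [y]) ↔
      ∀ o ∈ parkOutcome n (m - 2) (x :: M ++ [y]), o.isSome :=
    ⟨fun h => h.2.2, fun h => ⟨hlen, hmem, h⟩⟩
  rw [hmet, forall_isSome_parkOutcome_cons_concat_iff hM, nextFree_le_iff, hS]
  have hp := nextFree_spec (occupied M) x
  have hmemM : ∀ s, s ∈ occupied M ↔ (k < s ∧ s ≤ n) ∨ s ∈ occupied a := by
    simp [hocc]
  have hkM : k ∉ occupied M := by
    rw [hmemM]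
    rintro (h | h)
    · omega
    · have := ha k h
      omega
  have hjM : j ∉ occupied M := by
    rw [hmemM]
    rintro (h | h)
    · omega
    · exact hja.2.1 h
  have hfull : ∀ s, j < s → s ≤ n → s ≠ k → s ∈ occupied M := by
    intro s h1 h2 h3
    rw [hmemM]
    by_cases h : k < s
    · exact .inl ⟨h, h2⟩
    · exact .inr (hja.2.2 s h1 (by omega))
  have hle : ∀ s ∈ occupied M, s ≤ n := by
    intro s h
    rcases (hmemM s).1 h with h | h
    · exact h.2
    · have := ha s h
      omega
  clear_value a
  clear hmemM hocc hS hmet hmid hsh hj hmem hpf ha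
  generalize nextFree (occupied M) x = p at *
  simp only [Finset.mem_insert, Finset.mem_erase, forall_eq_or_imp]
  rcases le_or_gt x j with hxj | hxj
  · have hpj : p ≤ j := by
      by_contra h
      exact hjM (hp.2.2 j hxj (by omega))
    constructor
    · rintro ⟨-, s, h1, h2, h3⟩
      refine .inl ⟨hxj, ?_⟩
      by_contra h
      exact h3 ⟨by omega, .inr (hfull s (by omega) h2 (by omega))⟩
    · rintro (⟨-, h⟩ | h)
      · refine ⟨⟨by omega, hle⟩, k, h, hk.2, ?_⟩
        rintro ⟨-, h | h⟩
        · omega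
        · exact hkM h
      · omega
  · constructor
    · rintro ⟨⟨hpn, -⟩, s, h1, h2, h3⟩
      have hpk : p = k := by
        by_contra h
        exact hp.2.1 (hfull p (by omega) hpn h)
      refine .inr ⟨hxj, by omega, ?_⟩
      by_contra h
      refine h3 ⟨by omega, ?_⟩
      by_cases hs : s = p
      · exact .inl hs
      · exact .inr (hfull s (by omega) h2 (by omega))
    · rintro (h | ⟨-, hxk, hyx⟩)
      · omega
      · have hpk : p ≤ k := by
          by_contra h
          exact hkM (hp.2.2 k hxk (by omega))
        exact ⟨⟨by omega, hle⟩, x, hyx, hx1.2, fun h => h.1 rfl⟩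
end

section
/- For every integer m ≥ 2, the number of (m−2)-metered (m, m−1)-parking functions equals the sum of the first entries of all classical parking functions of length m−1; that is, mpf_{m,m−1}(m−2) = Σ_{(a_1, …, a_{m−1}) ∈ PF_{m−1,m−1}} a_1. -/
theorem length_parkOutcome (n t : ℕ) (l : List ℕ) :
    (parkOutcome n t l).length = l.length := by
  induction l using List.reverseRecOn with
  | nil => rfl
  | append_singleton l a ih => rw [parkOutcome_concat]; simp [parkStep, ih]

/-- Outcomes do not depend on the meter as long as no car leaves before the last one enters. -/
theorem parkOutcome_congr_meter (n : ℕ) {t t' : ℕ} (l : List ℕ) (h : l.length ≤ t + 1)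
    (h' : l.length ≤ t' + 1) : parkOutcome n t l = parkOutcome n t' l := by
  induction l using List.reverseRecOn with
  | nil => rfl
  | append_singleton l a ih =>
    simp only [List.length_append, List.length_singleton] at h h'
    rw [parkOutcome_concat, parkOutcome_concat, ih (by omega) (by omega)]
    simp only [parkStep, length_parkOutcome]
    rw [Nat.sub_eq_zero_of_le (show l.length ≤ t by omega),
      Nat.sub_eq_zero_of_le (show l.length ≤ t' by omega)]

theorem prefix_foldl_parkStep (n t : ℕ) (prev : List (Option ℕ)) (l : List ℕ) :
    prev <+: l.foldl (parkStep n t) prev := by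
  induction l generalizing prev with
  | nil => exact List.prefix_rfl
  | cons a l ih => exact (List.prefix_append _ _).trans (ih (parkStep n t prev a))

/-- The first car parks in its preferred spot. -/
theorem parkOutcome_cons (n t a : ℕ) (l : List ℕ) (ha : a ≤ n) :
    ∃ r, parkOutcome n t (a :: l) = some a :: r := by
  have hs : parkStep n t [] a = [some a] := by
    obtain ⟨k, hk⟩ : ∃ k, n + 1 - a = k + 1 := ⟨n - a, by omega⟩
    simp [parkStep, hk, List.range'_succ]
  obtain ⟨r, hr⟩ := prefix_foldl_parkStep n t [some a] l
  exact ⟨r, by rw [parkOutcome, List.foldl_cons, hs, ← hr]; rfl⟩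

/-- If no car leaves, the occupied spots are distinct and lie in `[n]`. -/
theorem nodup_parkOutcome (n t : ℕ) (l : List ℕ) (ht : l.length ≤ t + 1)
    (hl : ∀ x ∈ l, 1 ≤ x) :
    ((parkOutcome n t l).filterMap id).Nodup ∧
      ∀ s ∈ (parkOutcome n t l).filterMap id, s ∈ Finset.Icc 1 n := by
  induction l using List.reverseRecOn with
  | nil => simp [parkOutcome]
  | append_singleton l a ih =>
    simp only [List.length_append, List.length_singleton] at ht
    obtain ⟨h₁, h₂⟩ := ih (by omega) fun x hx => hl x (by simp [hx])
    have ha : 1 ≤ a := hl a (by simp)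
    rw [parkOutcome_concat]
    simp only [parkStep, length_parkOutcome, Nat.sub_eq_zero_of_le (show l.length ≤ t by omega),
      List.drop_zero, List.filterMap_append]
    set occ := (parkOutcome n t l).filterMap id
    rcases ho : ((List.range' a (n + 1 - a)).filter (fun s => decide (s ∉ occ))).head? with _ | s
    · simpa using ⟨h₁, by simpa using h₂⟩
    · have hs := List.mem_of_mem_head? ho
      simp only [List.mem_filter, List.mem_range'_1, decide_eq_true_eq] at hs
      have hf : List.filterMap id [some s] = [s] := rfl
      rw [hf]
      refine ⟨?_, fun x hx => ?_⟩
      · rw [List.nodup_append]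
        refine ⟨h₁, List.nodup_singleton s, fun x hx y hy => ?_⟩
        rintro rfl
        exact hs.2 (List.mem_singleton.1 hy ▸ hx)
      · rcases List.mem_append.1 hx with hx | hx
        · exact h₂ x hx
        · rw [List.mem_singleton.1 hx, Finset.mem_Icc]
          omega

theorem length_filterMap_id_of_isSome {α : Type*} (l : List (Option α))
    (h : ∀ o ∈ l, o.isSome) : (l.filterMap id).length = l.length := by
  induction l with
  | nil => rfl
  | cons o l ih =>
    obtain ⟨s, rfl⟩ := Option.isSome_iff_exists.1 (h o (by simp))
    simpa using ih fun o ho => h o (List.mem_cons_of_mem _ ho)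

theorem ParkingFunction.headI_mem_Icc {n : ℕ} (hn : 1 ≤ n) {l : List ℕ}
    (hl : ParkingFunction n n l) : l.headI ∈ Finset.Icc 1 n := by
  obtain ⟨hlen, hmem, -⟩ := hl
  cases l with
  | nil => simp at hlen; omega
  | cons b l => exact hmem b (by simp)

/-- After `n` cars have parked on `n` spots and the first has left, the next car parks if and
only if it prefers a spot no later than that of the first car. -/
theorem isSome_parkStep_iff {n : ℕ} (hn : 1 ≤ n) {l : List ℕ} (hl : ParkingFunction n n l)
    (a : ℕ) :
    (∀ o ∈ parkStep n (n - 1) (parkOutcome n (n - 1) l) a, o.isSome) ↔ a ≤ l.headI := by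
  have hh := hl.headI_mem_Icc hn
  obtain ⟨hlen, hmem, hsome⟩ := hl
  have ht : l.length ≤ n - 1 + 1 := by omega
  rw [parkOutcome_congr_meter n l (t' := n - 1) (by omega) ht] at hsome
  obtain ⟨hnd, hI⟩ := nodup_parkOutcome n (n - 1) l ht fun x hx => (Finset.mem_Icc.1 (hmem x hx)).1
  have hfl := length_filterMap_id_of_isSome _ hsome
  rw [length_parkOutcome, hlen] at hfl
  have hall : ∀ s ∈ Finset.Icc 1 n, s ∈ (parkOutcome n (n - 1) l).filterMap id := by
    have heq : ((parkOutcome n (n - 1) l).filterMap id).toFinset = Finset.Icc 1 n := by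
      refine Finset.eq_of_subset_of_card_le (fun s hs => hI s (List.mem_toFinset.1 hs)) ?_
      rw [List.toFinset_card_of_nodup hnd, hfl]
      simp
    intro s hs
    rwa [← heq, List.mem_toFinset] at hs
  have hdrop : (parkOutcome n (n - 1) l).length - (n - 1) = 1 := by
    rw [length_parkOutcome]; omega
  simp only [parkStep, hdrop]
  rw [Finset.mem_Icc] at hh
  obtain ⟨r, hr⟩ : ∃ r, parkOutcome n (n - 1) l = some l.headI :: r := by
    cases l with
    | nil => simp at hlen; omega
    | cons b l => exact parkOutcome_cons n (n - 1) b l hh.2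
  rw [hr] at hsome hnd hall ⊢
  have hcons : (some l.headI :: r).filterMap id = l.headI :: r.filterMap id := rfl
  rw [hcons] at hnd hall
  rw [List.nodup_cons] at hnd
  simp only [List.drop_one, List.tail_cons]
  constructor
  · intro h
    have h := h _ (List.mem_append_right _ (List.mem_singleton_self _))
    obtain ⟨s, hs⟩ := Option.isSome_iff_exists.1 h
    have hs := List.mem_of_mem_head? hs
    simp only [List.mem_filter, List.mem_range'_1, decide_eq_true_eq] at hs
    by_contra! hlt
    rcases List.mem_cons.1 (hall s (Finset.mem_Icc.2 (by omega))) with h | h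
    · omega
    · exact hs.2 h
  · intro ha o ho
    rcases List.mem_append.1 ho with ho | ho
    · exact hsome o ho
    · rw [List.mem_singleton.1 ho, List.isSome_head?]
      refine List.ne_nil_of_mem (a := l.headI) ?_
      simp only [List.mem_filter, List.mem_range'_1, decide_eq_true_eq]
      exact ⟨⟨ha, by omega⟩, hnd.1⟩

theorem meteredPF_concat_iff {n : ℕ} (hn : 1 ≤ n) (l : List ℕ) (a : ℕ) :
    MeteredPF (n + 1) n (n - 1) (l ++ [a]) ↔
      ParkingFunction n n l ∧ a ∈ Finset.Icc 1 l.headI := by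
  have hcongr (hlen : l.length = n) : parkOutcome n n l = parkOutcome n (n - 1) l :=
    parkOutcome_congr_meter n l (by omega) (by omega)
  constructor
  · rintro ⟨hlen, hmem, hsome⟩
    simp only [List.length_append, List.length_singleton, Nat.add_right_cancel_iff] at hlen
    rw [parkOutcome_concat] at hsome
    have hl : ParkingFunction n n l := by
      refine ⟨hlen, fun x hx => hmem x (by simp [hx]), fun o ho => ?_⟩
      rw [hcongr hlen] at ho
      exact hsome o (List.mem_append_left _ ho)
    exact ⟨hl, Finset.mem_Icc.2 ⟨(Finset.mem_Icc.1 (hmem a (by simp))).1,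
      (isSome_parkStep_iff hn hl a).1 hsome⟩⟩
  · rintro ⟨hl, ha⟩
    have hh := hl.headI_mem_Icc hn
    rw [Finset.mem_Icc] at ha hh
    refine ⟨by simp [hl.1], fun x hx => ?_, ?_⟩
    · rcases List.mem_append.1 hx with hx | hx
      · exact hl.2.1 x hx
      · rw [List.mem_singleton.1 hx, Finset.mem_Icc]
        omega
    · rw [parkOutcome_concat]
      exact (isSome_parkStep_iff hn hl a).2 ha.2

theorem finite_setOf_parkingFunction (m n : ℕ) : {l : List ℕ | ParkingFunction m n l}.Finite := by
  refine (List.finite_length_eq (Fin (n + 1)) m |>.image (List.map Fin.val)).subset ?_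
  rintro l ⟨hlen, hmem, -⟩
  have hlt : ∀ x ∈ l, x < n + 1 := fun x hx => Nat.lt_succ_of_le (Finset.mem_Icc.1 (hmem x hx)).2
  exact ⟨l.pmap Fin.mk hlt, by simpa using hlen, by simp [List.map_pmap]⟩

/-- For every integer `m ≥ 2`, the number of `(m-2)`-metered
`(m, m-1)`-parking functions equals the sum of the first entries of all classical
parking functions of length `m-1`. -/
theorem mpf_eq_sum_first_entries (m : ℕ) (hm : 2 ≤ m) :
    Set.ncard {l : List ℕ | MeteredPF m (m - 1) (m - 2) l} =
      ∑ᶠ l ∈ {l : List ℕ | ParkingFunction (m - 1) (m - 1) l}, l.headI := by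
  obtain ⟨n, rfl⟩ : ∃ n, m = n + 1 := ⟨m - 1, by omega⟩
  have hn : 1 ≤ n := by omega
  simp only [Nat.add_sub_cancel, show n + 1 - 2 = n - 1 by omega]
  have hfin := finite_setOf_parkingFunction n n
  have himage : {l : List ℕ | MeteredPF (n + 1) n (n - 1) l} =
      ((hfin.toFinset.sigma fun l => Finset.Icc 1 l.headI).image
        fun p : (_ : List ℕ) × ℕ => p.1 ++ [p.2] : Finset (List ℕ)) := by
    ext l
    rcases l.eq_nil_or_concat with rfl | ⟨l, a, rfl⟩
    · simp [MeteredPF]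
    · rw [Set.mem_ofPred_eq, List.concat_eq_append, meteredPF_concat_iff hn]
      simp [List.append_singleton_inj, and_assoc]
  rw [himage, Set.ncard_coe_finset, Finset.card_image_of_injective, Finset.card_sigma,
    finsum_mem_eq_finite_toFinset_sum _ hfin]
  · simp
  · rintro ⟨l, a⟩ ⟨l', a'⟩ h
    obtain ⟨rfl, rfl⟩ := List.append_singleton_inj.1 h
    rfl
end
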